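/- Let ≺ be a transitive relation on ℕ. For every valuation ν on the space of ideals I(≺), the set f_V(ν) = { r ∈ B : ∑_{b∈F} r(b) < ν(⋃_{b∈F} [b]_≺) for every nonempty F ⊆ dom(r) } is an ideal with respect to ≺_V (it is nonempty, a lower set, and directed). -/

import Mathlib

open TopologicalSpace
open scoped Classical NNRat NNReal ENNReal

/-- An ideal with respect to a (transitive) relation: a nonempty, lower, directed subset. -/
def IsIdeal {α : Type*} (prec : α → α → Prop) (I : Set α) : Prop :=
  I.Nonempty ∧ (∀ a ∈ I, ∀ b, prec b a → b ∈ I) ∧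
    ∀ a ∈ I, ∀ b ∈ I, ∃ c ∈ I, prec a c ∧ prec b c

/-- The space of ideals of a relation. -/
def IdealSpace {α : Type*} (prec : α → α → Prop) : Type _ := {I : Set α // IsIdeal prec I}

/-- The basic open set `[n]_≺ = {I ∈ I(≺) : n ∈ I}`. -/
def basicOpen {α : Type*} (prec : α → α → Prop) (n : α) : Set (IdealSpace prec) :=
  {I | n ∈ I.1}

/-- The topology on the space of ideals, generated by the basic open sets. -/
instance {α : Type*} (prec : α → α → Prop) : TopologicalSpace (IdealSpace prec) :=
  TopologicalSpace.generateFrom {U | ∃ n, U = basicOpen prec n}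

theorem isOpen_basicOpen {α : Type*} (prec : α → α → Prop) (n : α) :
    IsOpen (basicOpen prec n) :=
  TopologicalSpace.isOpen_generateFrom_of_mem ⟨n, rfl⟩

/-- `[n]_≺` as an element of the open-set lattice. -/
def basicOpens {α : Type*} (prec : α → α → Prop) (n : α) : Opens (IdealSpace prec) :=
  ⟨basicOpen prec n, isOpen_basicOpen prec n⟩

/-- The relation `≺_V` on the set `B` of partial functions from `ℕ` to the positive
rationals with finite domain (modelled as finitely supported functions `ℕ →₀ ℚ≥0`,
with domain the support):  `r ≺_V s` iff for every nonempty `F ⊆ dom r`,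
`∑_{b ∈ F} r b < ∑_{c ∈ ↑F ∩ dom s} s c`, where `↑F = {c | ∃ b ∈ F, b ≺ c}`. -/
def precV (prec : ℕ → ℕ → Prop) (r s : ℕ →₀ ℚ≥0) : Prop :=
  ∀ F : Finset ℕ, F.Nonempty → F ⊆ r.support →
    ∑ b ∈ F, r b < ∑ c ∈ s.support.filter (fun c => ∃ b ∈ F, prec b c), s c

/-- The relation `≺_U` on finite subsets of `ℕ`. -/
def precU (prec : ℕ → ℕ → Prop) (F G : Finset ℕ) : Prop :=
  ∀ n ∈ G, ∃ m ∈ F, prec m n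

/-- A (Scott-continuous) valuation on a topological space: a Scott-continuous, strict,
modular function from the open-set lattice to `[0,∞]`. -/
structure Valuation' (X : Type*) [TopologicalSpace X] where
  toFun : Opens X → ℝ≥0∞
  scott' : ScottContinuous toFun
  strict' : toFun ⊥ = 0
  modular' : ∀ U V : Opens X, toFun U + toFun V = toFun (U ⊔ V) + toFun (U ⊓ V)

/-- The weak topology on the space of valuations, generated by the subbasic opens
`⟨U, q⟩ = {ν | ν U > q}` for `U` open and `q < ∞`. -/
instance {X : Type*} [TopologicalSpace X] : TopologicalSpace (Valuation' X) :=
  TopologicalSpace.generateFrom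
    {S | ∃ (U : Opens X) (q : ℝ≥0∞), q ≠ ⊤ ∧ S = {ν : Valuation' X | q < ν.toFun U}}

/-- The union `⋃_{b ∈ F} [b]_≺` as an open set. -/
def unionOpens (prec : ℕ → ℕ → Prop) (F : Finset ℕ) : Opens (IdealSpace prec) :=
  ⟨⋃ b ∈ F, basicOpen prec b, isOpen_biUnion fun b _ => isOpen_basicOpen prec b⟩

/-- The set `f_V(ν) = {r ∈ B | ∑_{b∈F} r b < ν (⋃_{b∈F} [b]_≺) for every nonempty F ⊆ dom r}`. -/
def fVset (prec : ℕ → ℕ → Prop) (ν : Valuation' (IdealSpace prec)) : Set (ℕ →₀ ℚ≥0) :=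
  {r | ∀ F : Finset ℕ, F.Nonempty → F ⊆ r.support →
    (∑ b ∈ F, ((r b : ℝ≥0) : ℝ≥0∞)) < ν.toFun (unionOpens prec F)}

/-- The function `g_V(I) = λ U. ⨆ {∑_{b ∈ dom r} r b | r ∈ I and ⋃_{b ∈ dom r} [b]_≺ ⊆ U}`. -/
noncomputable def gVfun (prec : ℕ → ℕ → Prop) (I : Set (ℕ →₀ ℚ≥0))
    (U : Opens (IdealSpace prec)) : ℝ≥0∞ :=
  ⨆ r ∈ {r : ℕ →₀ ℚ≥0 | r ∈ I ∧ unionOpens prec r.support ≤ U},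
    ∑ b ∈ r.support, ((r b : ℝ≥0) : ℝ≥0∞)

/-- The set `g_U(J) = {I ∈ I(≺) | ∀ F ∈ J, ∃ m ∈ I, m ∈ F}`. -/
def gUset (prec : ℕ → ℕ → Prop) (J : Set (Finset ℕ)) : Set (IdealSpace prec) :=
  {I | ∀ F ∈ J, ∃ m ∈ I.1, m ∈ F}

/-- The mass of `U n` outside the union of the `U m` whose key precedes that of `n`
(truncated to `0` when that union already takes up infinite mass of `U n`). -/
noncomputable def residualMass {X ι κ : Type*} [TopologicalSpace X] [LT κ]
    (ν : Valuation' X) (U : ι → Opens X) (k : ι → κ) (n : ι) : ℝ≥0∞ :=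
  ν.toFun (U n) - ν.toFun (U n ⊓ ⨆ m, ⨆ _ : k m < k n, U m)

namespace Valuation'

variable {X ι κ : Type*} [TopologicalSpace X] (ν : Valuation' X)

theorem mono {U V : Opens X} (h : U ≤ V) : ν.toFun U ≤ ν.toFun V :=
  ν.scott'.monotone h

theorem add_sub_le_sup {O W V : Opens X} (h : W ≤ V) :
    ν.toFun W + (ν.toFun O - ν.toFun (O ⊓ V)) ≤ ν.toFun (W ⊔ O) := by
  have hmod := ν.modular' W O
  rw [inf_comm W O] at hmod
  have hle : ν.toFun (O ⊓ W) ≤ ν.toFun (O ⊓ V) := ν.mono (inf_le_inf_left O h)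
  by_cases htop : ν.toFun (O ⊓ W) = ⊤
  · have : ν.toFun (W ⊔ O) = ⊤ :=
      top_le_iff.1 (htop ▸ ν.mono (inf_le_right.trans le_sup_left))
    simp [this]
  · calc ν.toFun W + (ν.toFun O - ν.toFun (O ⊓ V))
        ≤ ν.toFun W + (ν.toFun O - ν.toFun (O ⊓ W)) := by gcongr
      _ = ν.toFun W + ν.toFun O - ν.toFun (O ⊓ W) :=
        (ENNReal.cancel_of_ne htop).add_tsub_assoc_of_le (ν.mono inf_le_left) _ |>.symm
      _ = ν.toFun (W ⊔ O) := by rw [hmod, ENNReal.add_sub_cancel_right htop]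

theorem sup_le_add_sub {O W V : Opens X} (h : O ⊓ V ≤ W) :
    ν.toFun (W ⊔ O) ≤ ν.toFun W + (ν.toFun O - ν.toFun (O ⊓ V)) := by
  by_cases htop : ν.toFun (O ⊓ V) = ⊤
  · have : ν.toFun W = ⊤ := top_le_iff.1 (htop ▸ ν.mono h)
    simp [this]
  · have hmod := ν.modular' W O
    have hle : ν.toFun (O ⊓ V) ≤ ν.toFun (W ⊓ O) := ν.mono (le_inf h inf_le_left)
    refine ENNReal.le_of_add_le_add_right htop ?_
    rw [add_assoc, tsub_add_cancel_of_le (ν.mono inf_le_left), hmod]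
    gcongr

/-- Scott continuity along a chain, the empty chain included. -/
theorem iSup_le_of_chain [LinearOrder κ] (k : ι → κ) (M : Set ι) (V : ι → Opens X)
    (hV : ∀ m n, k m ≤ k n → V m ≤ V n) {c : ℝ≥0∞} (hc : ∀ m ∈ M, ν.toFun (V m) ≤ c) :
    ν.toFun (⨆ m ∈ M, V m) ≤ c := by
  rcases M.eq_empty_or_nonempty with rfl | hM
  · simp [ν.strict']
  · have hdir : DirectedOn (· ≤ ·) (V '' M) := by
      rintro _ ⟨m, hm, rfl⟩ _ ⟨n, hn, rfl⟩
      rcases le_total (k m) (k n) with h | h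
      · exact ⟨_, ⟨n, hn, rfl⟩, hV _ _ h, le_rfl⟩
      · exact ⟨_, ⟨m, hm, rfl⟩, le_rfl, hV _ _ h⟩
    have hlub : IsLUB (V '' M) (⨆ m ∈ M, V m) := by
      rw [← sSup_image]
      exact isLUB_sSup _
    refine (isLUB_le_iff (ν.scott' (hM.image V) hdir hlub)).2 ?_
    rintro _ ⟨_, ⟨m, hm, rfl⟩, rfl⟩
    exact hc m hm

theorem sum_residualMass_le [LinearOrder κ] (U : ι → Opens X) {k : ι → κ}
    (hk : Function.Injective k) (G : Finset ι) :
    ∑ n ∈ G, residualMass ν U k n ≤ ν.toFun (⨆ n ∈ G, U n) := by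
  induction G using Finset.induction_on_max_value k with
  | empty => simp
  | insert a G ha hmax ih =>
    have hlt : ⨆ n ∈ G, U n ≤ ⨆ m, ⨆ _ : k m < k a, U m :=
      iSup₂_le fun n hn => le_iSup₂_of_le n
        ((hmax n hn).lt_of_ne fun h => ha (hk h ▸ hn)) le_rfl
    rw [Finset.sum_insert ha, Finset.iSup_insert, add_comm, sup_comm]
    exact (add_le_add_left ih _).trans (ν.add_sub_le_sup hlt)

/-- If `T` absorbs the intersections of its members with their predecessors, the residual
masses on `T` exhaust the valuation of its union. -/
theorem le_tsum_residualMass [LinearOrder κ] [WellFoundedLT κ] (U : ι → Opens X) {k : ι → κ}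
    (hk : Function.Injective k) (T : Set ι)
    (hT : ∀ n ∈ T, ∀ i, k i < k n → U n ⊓ U i ≤ ⨆ m ∈ {m | m ∈ T ∧ k m < k n}, U m) :
    ν.toFun (⨆ n ∈ T, U n) ≤ ∑' n, T.indicator (residualMass ν U k) n := by
  set w := residualMass ν U k
  let V : ι → Opens X := fun n => ⨆ m ∈ {m | m ∈ T ∧ k m ≤ k n}, U m
  have hV : ∀ m n, k m ≤ k n → V m ≤ V n := fun m n h =>
    biSup_mono fun i (hi : i ∈ T ∧ k i ≤ k m) => ⟨hi.1, hi.2.trans h⟩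
  have hUV : ∀ n ∈ T, U n ≤ V n := fun n hn =>
    le_biSup U (i := n) (show n ∈ {m | m ∈ T ∧ k m ≤ k n} from ⟨hn, le_rfl⟩)
  have key : ∀ n ∈ T, ν.toFun (V n) ≤ ∑' m, {m | m ∈ T ∧ k m ≤ k n}.indicator w m := by
    intro n
    induction n using (InvImage.wf k (wellFounded_lt (α := κ))).induction with
    | _ n ih =>
    intro hn
    let W : Opens X := ⨆ m ∈ {m | m ∈ T ∧ k m < k n}, U m
    have hW : ν.toFun W ≤ ∑' m, {m | m ∈ T ∧ k m < k n}.indicator w m := by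
      have hle : W ≤ ⨆ m ∈ {m | m ∈ T ∧ k m < k n}, V m :=
        iSup₂_mono fun m hm => hUV m hm.1
      refine (ν.mono hle).trans (ν.iSup_le_of_chain k _ V hV fun m hm => ?_)
      refine (ih m hm.2 hm.1).trans (ENNReal.tsum_le_tsum fun i => ?_)
      have hsub : {j | j ∈ T ∧ k j ≤ k m} ⊆ {j | j ∈ T ∧ k j < k n} :=
        fun j hj => ⟨hj.1, hj.2.trans_lt hm.2⟩
      exact Set.indicator_le_indicator_of_subset hsub (fun _ => zero_le) i
    have hVW : V n ≤ W ⊔ U n := iSup₂_le fun m hm => by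
      rcases hm.2.lt_or_eq with h | h
      · exact le_sup_of_le_left
          (le_biSup U (i := m) (show m ∈ {m | m ∈ T ∧ k m < k n} from ⟨hm.1, h⟩))
      · exact hk h ▸ le_sup_right
    have hinf : U n ⊓ ⨆ m, ⨆ _ : k m < k n, U m ≤ W := by
      simp only [inf_iSup_eq]
      exact iSup₂_le fun i hi => hT n hn i hi
    calc ν.toFun (V n) ≤ ν.toFun W + w n := (ν.mono hVW).trans (ν.sup_le_add_sub hinf)
      _ ≤ ∑' m, {m | m ∈ T ∧ k m < k n}.indicator w m + ∑' m, if m = n then w n else 0 := by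
        rw [tsum_ite_eq]
        gcongr
      _ = ∑' m, ({m | m ∈ T ∧ k m < k n}.indicator w m + if m = n then w n else 0) :=
        ENNReal.tsum_add.symm
      _ ≤ ∑' m, {m | m ∈ T ∧ k m ≤ k n}.indicator w m := ENNReal.tsum_le_tsum fun m => by
        by_cases hm : m = n
        · subst hm
          simp [hn]
        · by_cases hm' : m ∈ T ∧ k m < k n
          · simp [hm, hm', hm'.2.le]
          · simp [hm, hm']
  have hle : ⨆ n ∈ T, U n ≤ ⨆ n ∈ T, V n := iSup₂_mono hUV
  refine (ν.mono hle).trans (ν.iSup_le_of_chain k T V hV fun n hn => ?_)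
  refine (key n hn).trans (ENNReal.tsum_le_tsum fun i => ?_)
  exact Set.indicator_le_indicator_of_subset (fun j hj => hj.1) (fun _ => zero_le) i

end Valuation'

theorem unionOpens_eq_iSup (prec : ℕ → ℕ → Prop) (F : Finset ℕ) :
    unionOpens prec F = ⨆ b ∈ F, basicOpens prec b := by
  ext I
  simp [unionOpens, basicOpens]

theorem unionOpens_eq_iSup_upper (prec : ℕ → ℕ → Prop) (F : Finset ℕ) :
    unionOpens prec F = ⨆ c ∈ {c | ∃ b ∈ F, prec b c}, basicOpens prec c := by
  ext I
  simp only [unionOpens_eq_iSup, Opens.coe_iSup, Set.mem_iUnion, exists_prop, Set.mem_ofPred_eq]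
  constructor
  · rintro ⟨b, hb, hI⟩
    obtain ⟨c, hc, hbc, -⟩ := I.2.2.2 b hI b hI
    exact ⟨c, ⟨b, hb, hbc⟩, hc⟩
  · rintro ⟨c, ⟨b, hb, hbc⟩, hI⟩
    exact ⟨b, hb, I.2.2.1 c hI b hbc⟩

/-- The key ordering `ℕ` by decreasing number of predecessors in `D`, ties broken by `≤`. -/
noncomputable def predKey (prec : ℕ → ℕ → Prop) (D : Finset ℕ) (n : ℕ) : ℕ ×ₗ ℕ :=
  toLex (D.card - (D.filter fun b => prec b n).card, n)

theorem predKey_injective (prec : ℕ → ℕ → Prop) (D : Finset ℕ) :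
    Function.Injective (predKey prec D) := fun _ _ h =>
  congrArg (fun p => (ofLex p).2) h

theorem unionOpens_le_tsum (prec : ℕ → ℕ → Prop) (htrans : Transitive prec)
    (ν : Valuation' (IdealSpace prec)) {D F : Finset ℕ} (hF : F ⊆ D) :
    ν.toFun (unionOpens prec F) ≤ ∑' n, {c | ∃ b ∈ F, prec b c}.indicator
      (residualMass ν (basicOpens prec) (predKey prec D)) n := by
  rw [unionOpens_eq_iSup_upper]
  refine ν.le_tsum_residualMass _ (predKey_injective prec D) _ ?_
  rintro n ⟨b, hb, hbn⟩ i hi I ⟨hIn, hIi⟩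
  suffices ∃ m, ((∃ b ∈ F, prec b m) ∧ predKey prec D m < predKey prec D n) ∧ m ∈ I.1 by
    simpa [basicOpens, basicOpen] using this
  by_cases hiF : ∃ b ∈ F, prec b i
  · exact ⟨i, ⟨hiF, hi⟩, hIi⟩
  · obtain ⟨m, hm, hnm, him⟩ := I.2.2.2 n hIn i hIi
    refine ⟨m, ⟨⟨b, hb, htrans hbn hnm⟩, ?_⟩, hm⟩
    have hss : (D.filter fun b => prec b i) ⊂ D.filter fun b => prec b m := by
      refine Finset.ssubset_iff_subset_ne.2 ⟨fun a ha => ?_, fun h => hiF ⟨b, hb, ?_⟩⟩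
      · simp only [Finset.mem_filter] at ha ⊢
        exact ⟨ha.1, htrans ha.2 him⟩
      · have : b ∈ D.filter fun b => prec b m :=
          Finset.mem_filter.2 ⟨hF hb, htrans hbn hnm⟩
        rw [← h] at this
        exact (Finset.mem_filter.1 this).2
    have h1 := Finset.card_lt_card hss
    have h2 := Finset.card_filter_le D fun b => prec b m
    simp only [predKey, Prod.Lex.toLex_lt_toLex] at hi ⊢
    omega

theorem exists_nnrat_seq_tendsto (x : ℝ≥0∞) :
    ∃ u : ℕ → ℚ≥0, (∀ j, u j ≠ 0 → ((u j : ℝ≥0) : ℝ≥0∞) < x) ∧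
      Filter.Tendsto (fun j => ((u j : ℝ≥0) : ℝ≥0∞)) Filter.atTop (nhds x) := by
  rcases eq_or_ne x 0 with rfl | hx
  · exact ⟨fun _ => 0, by simp, by simp⟩
  · obtain ⟨v, -, hv, hlim⟩ := exists_seq_strictMono_tendsto' (pos_iff_ne_zero.2 hx)
    have hq : ∀ j, ∃ q : ℚ≥0, v j < ((q : ℝ≥0) : ℝ≥0∞) ∧ ((q : ℝ≥0) : ℝ≥0∞) < x := fun j => by
      obtain ⟨q, hq0, h1, h2⟩ := ENNReal.lt_iff_exists_rat_btwn.1 (hv j).2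
      lift q to ℚ≥0 using hq0
      have : Real.toNNReal ((q : ℚ) : ℝ) = (q : ℝ≥0) := by
        ext
        rw [Real.coe_toNNReal', Rat.cast_nnratCast, max_eq_left q.cast_nonneg]
        exact (map_nnratCast NNReal.toRealHom q).symm
      exact ⟨q, this ▸ h1, this ▸ h2⟩
    choose u hvu hux using hq
    exact ⟨u, fun j _ => hux j, tendsto_of_tendsto_of_tendsto_of_le_of_le hlim
      tendsto_const_nhds (fun j => (hvu j).le) fun j => (hux j).le⟩

theorem eventually_sum_lt {ι α : Type*} {l : Filter α} {f : α → Finset ι → ℝ≥0∞}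
    {L c : Finset ι → ℝ≥0∞} (D : Finset ι)
    (hf : ∀ F ⊆ D, Filter.Tendsto (fun a => f a F) l (nhds (L F)))
    (hc : ∀ F : Finset ι, F.Nonempty → F ⊆ D → c F < L F) :
    ∀ᶠ a in l, ∀ F : Finset ι, F.Nonempty → F ⊆ D → c F < f a F := by
  have : ∀ᶠ a in l, ∀ F ∈ D.powerset, F.Nonempty → c F < f a F :=
    (Filter.eventually_all_finset _).2 fun F hF => by
      by_cases hne : F.Nonempty
      · filter_upwards [(hf F (Finset.mem_powerset.1 hF)).eventually_const_lt
          (hc F hne (Finset.mem_powerset.1 hF))] with a ha _ using ha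
      · exact Filter.Eventually.of_forall fun _ h => absurd h hne
  filter_upwards [this] with a ha F hne hF using ha F (Finset.mem_powerset.2 hF) hne

theorem fVset_directed (prec : ℕ → ℕ → Prop) (htrans : Transitive prec)
    (ν : Valuation' (IdealSpace prec)) {r₁ r₂ : ℕ →₀ ℚ≥0}
    (h₁ : r₁ ∈ fVset prec ν) (h₂ : r₂ ∈ fVset prec ν) :
    ∃ s ∈ fVset prec ν, precV prec r₁ s ∧ precV prec r₂ s := by
  set D := r₁.support ∪ r₂.support
  set w := residualMass ν (basicOpens prec) (predKey prec D)
  let up : Finset ℕ → Set ℕ := fun F => {c | ∃ b ∈ F, prec b c}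
  have hS : ∀ r ∈ fVset prec ν, r.support ⊆ D → ∀ᶠ S : Finset ℕ in Filter.atTop,
      ∀ F : Finset ℕ, F.Nonempty → F ⊆ r.support →
        ∑ b ∈ F, ((r b : ℝ≥0) : ℝ≥0∞) < ∑ n ∈ S, (up F).indicator w n := fun r hr hrD =>
    eventually_sum_lt _ (fun F _ => ENNReal.summable.hasSum) fun F hne hF =>
      (hr F hne hF).trans_le (unionOpens_le_tsum prec htrans ν (hF.trans hrD))
  obtain ⟨S, hS₁, hS₂⟩ := ((hS r₁ h₁ Finset.subset_union_left).and
    (hS r₂ h₂ Finset.subset_union_right)).exists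
  choose u hu hlim using fun n => exists_nnrat_seq_tendsto (w n)
  have hj : ∀ r : ℕ →₀ ℚ≥0, (∀ F : Finset ℕ, F.Nonempty → F ⊆ r.support →
        ∑ b ∈ F, ((r b : ℝ≥0) : ℝ≥0∞) < ∑ n ∈ S, (up F).indicator w n) →
      ∀ᶠ j in Filter.atTop, ∀ F : Finset ℕ, F.Nonempty → F ⊆ r.support →
        ∑ b ∈ F, ((r b : ℝ≥0) : ℝ≥0∞) <
          ∑ n ∈ S, (up F).indicator (fun n => ((u n j : ℝ≥0) : ℝ≥0∞)) n := fun r hr =>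
    eventually_sum_lt _ (fun F _ => tendsto_finsetSum _ fun n _ => by
      by_cases hn : n ∈ up F
      · simpa [hn] using hlim n
      · simp [hn]) hr
  obtain ⟨j, hj₁, hj₂⟩ := ((hj r₁ hS₁).and (hj r₂ hS₂)).exists
  let s : ℕ →₀ ℚ≥0 := Finsupp.onFinset S (fun n => if n ∈ S then u n j else 0) (by simp +contextual)
  have hs : ∀ n ∈ S, s n = u n j := fun n hn => by simp [s, hn]
  have hsS : s.support ⊆ S := Finsupp.support_onFinset_subset
  have hprec : ∀ r : ℕ →₀ ℚ≥0, (∀ F : Finset ℕ, F.Nonempty → F ⊆ r.support →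
        ∑ b ∈ F, ((r b : ℝ≥0) : ℝ≥0∞) <
          ∑ n ∈ S, (up F).indicator (fun n => ((u n j : ℝ≥0) : ℝ≥0∞)) n) →
      precV prec r s := by
    intro r hr F hne hF
    have hsum : ∑ n ∈ S, (up F).indicator (fun n => ((u n j : ℝ≥0) : ℝ≥0∞)) n =
        ∑ c ∈ s.support.filter (fun c => ∃ b ∈ F, prec b c), ((s c : ℝ≥0) : ℝ≥0∞) := by
      rw [Finset.sum_filter]
      refine (Finset.sum_subset_zero_on_sdiff hsS (fun n hn => ?_) fun n hn => ?_).symm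
      · have h0 : u n j = 0 := by
          rw [Finset.mem_sdiff, Finsupp.notMem_support_iff] at hn
          rw [← hs n hn.1, hn.2]
        simp [Set.indicator_apply, h0]
      · simp only [Set.indicator_apply, hs n (hsS hn)]
        rfl
    have := hr F hne hF
    rw [hsum] at this
    exact_mod_cast this
  refine ⟨s, fun G hne hG => ?_, hprec r₁ hj₁, hprec r₂ hj₂⟩
  calc ∑ b ∈ G, ((s b : ℝ≥0) : ℝ≥0∞) < ∑ b ∈ G, w b :=
        ENNReal.sum_lt_sum_of_nonempty hne fun n hn => by
          have hn' := hs n (hsS (hG hn))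
          rw [hn']
          exact hu n j (hn' ▸ Finsupp.mem_support_iff.1 (hG hn))
    _ ≤ ν.toFun (⨆ n ∈ G, basicOpens prec n) :=
        ν.sum_residualMass_le _ (predKey_injective prec D) G
    _ = ν.toFun (unionOpens prec G) := by rw [unionOpens_eq_iSup]

theorem fVset_lower (prec : ℕ → ℕ → Prop) (ν : Valuation' (IdealSpace prec))
    {r s : ℕ →₀ ℚ≥0} (hr : r ∈ fVset prec ν) (hsr : precV prec s r) : s ∈ fVset prec ν := by
  intro F hne hF
  set G := r.support.filter fun c => ∃ b ∈ F, prec b c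
  have hlt : ∑ b ∈ F, s b < ∑ c ∈ G, r c := hsr F hne hF
  have hG : G.Nonempty := by
    by_contra h
    simp [Finset.not_nonempty_iff_eq_empty.1 h] at hlt
  have hle : unionOpens prec G ≤ unionOpens prec F := by
    rw [unionOpens_eq_iSup, unionOpens_eq_iSup_upper]
    exact biSup_mono fun c hc => (Finset.mem_filter.1 hc).2
  calc ∑ b ∈ F, ((s b : ℝ≥0) : ℝ≥0∞) < ∑ c ∈ G, ((r c : ℝ≥0) : ℝ≥0∞) := by exact_mod_cast hlt
    _ < ν.toFun (unionOpens prec G) := hr G hG (Finset.filter_subset _ _)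
    _ ≤ ν.toFun (unionOpens prec F) := ν.mono hle

/-- For every valuation `ν` on `I(≺)`, the set `f_V(ν)` is an ideal with
respect to `≺_V`. -/
theorem fVset_isIdeal (prec : ℕ → ℕ → Prop) (htrans : Transitive prec)
    (ν : Valuation' (IdealSpace prec)) :
    IsIdeal (precV prec) (fVset prec ν) := by
  refine ⟨⟨0, fun F hne hF => ?_⟩, fun r hr s hsr => fVset_lower prec ν hr hsr,
    fun r₁ h₁ r₂ h₂ => fVset_directed prec htrans ν h₁ h₂⟩
  simp [Finset.subset_empty.1 hF] at hne
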